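/- For all natural numbers j and k with j ≤ k, the following identity of polynomials in q holds: Σ over pairs (P, w), where P is a Motzkin path of length k+j with exactly j up steps, j down steps and k−j level steps, and w assigns weight 1 to each up step, weight −q^h to each level step starting at height h, and a weight in {1, −q^h} to each down step starting at height h, such that P has no peak (an up step immediately followed by a down step) both of whose steps are assigned weight 1, of the product of the assigned weights of all steps, equals (−1)^k · q^{j(j+1)/2} · [k choose j]_q, where [k choose j]_q is the Gaussian (q-)binomial coefficient. -/

import Mathlib

open Finset

inductive Step : Type
  | U | L | D
deriving DecidableEq

instance : Fintype Step where
  elems := ⟨[Step.U, Step.L, Step.D], by decide⟩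
  complete := by intro x; cases x <;> decide

/-- The vertical displacement of a step: up = +1, level = 0, down = -1. -/
def Step.val : Step → ℤ
  | .U => 1
  | .L => 0
  | .D => -1

/-- The partial sum of the step values of the first `i` steps;
this is the height at which step `i` starts. -/
def hsum {n : ℕ} (P : Fin n → Step) (i : ℕ) : ℤ :=
  ∑ j ∈ Finset.univ.filter (fun j : Fin n => (j : ℕ) < i), (P j).val

/-- A Motzkin path: all partial sums nonnegative and total sum 0. -/
abbrev IsMotzkin {n : ℕ} (P : Fin n → Step) : Prop :=
  (∀ i : Fin (n+1), 0 ≤ hsum P (i : ℕ)) ∧ hsum P n = 0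

/-- A Motzkin prefix of final height `k`: all partial sums nonnegative, total sum `k`. -/
abbrev IsMPrefix {n : ℕ} (P : Fin n → Step) (k : ℕ) : Prop :=
  (∀ i : Fin (n+1), 0 ≤ hsum P (i : ℕ)) ∧ hsum P n = (k : ℤ)

/-- `[h]_q = 1 + q + ... + q^(h-1)`. -/
def geo {R : Type*} [CommSemiring R] (q : R) (h : ℤ) : R :=
  ∑ i ∈ Finset.range h.toNat, q ^ i

/-- The Gaussian (q-)binomial coefficient, via the q-Pascal recurrence. -/
def qbinom {R : Type*} [CommSemiring R] (q : R) : ℕ → ℕ → R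
  | _, 0 => 1
  | 0, _+1 => 0
  | n+1, k+1 => qbinom q n k + q ^ (k+1) * qbinom q n (k+1)

/-- The binomial coefficient with integer lower argument, zero on negative arguments. -/
def ch (m : ℕ) (j : ℤ) : ℤ := if 0 ≤ j then m.choose j.toNat else 0

open Polynomial in
noncomputable def wt (h : ℤ) (s : Step) (b : Bool) : Polynomial ℤ :=
  match s with
  | Step.U => (1 : Polynomial ℤ)
  | Step.L => -(X : Polynomial ℤ) ^ h.toNat
  | Step.D => if b then 1 else -(X : Polynomial ℤ) ^ h.toNat

def Cnd (n : ℕ) (h : ℤ) (p : Prop) (u d l : ℤ) (P : Fin n → Step) (w : Fin n → Bool) : Prop :=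
  (∀ i : ℕ, i ≤ n → 0 ≤ h + hsum P i) ∧ h + hsum P n = 0 ∧
  (∑ i, if P i = Step.U then (1:ℤ) else 0) = u ∧
  (∑ i, if P i = Step.D then (1:ℤ) else 0) = d ∧
  (∑ i, if P i = Step.L then (1:ℤ) else 0) = l ∧
  (∀ i, P i ≠ Step.D → w i = true) ∧
  (∀ a b : Fin n, (b : ℕ) = (a : ℕ) + 1 → ¬(P a = Step.U ∧ P b = Step.D ∧ w b = true)) ∧
  (p → ∀ b : Fin n, (b : ℕ) = 0 → ¬ (P b = Step.D ∧ w b = true))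

lemma hsum_zero {n : ℕ} (P : Fin n → Step) : hsum P 0 = 0 := by simp [hsum]

lemma hsum_cons {n : ℕ} (s : Step) (P : Fin n → Step) (i : ℕ) :
    hsum (Fin.cons s P : Fin (n+1) → Step) (i+1) = s.val + hsum P i := by
  simp [hsum, Finset.sum_filter, Fin.sum_univ_succ]

lemma Cnd_cons (n : ℕ) (h : ℤ) (p : Prop) (u d l : ℤ) (s : Step) (b : Bool)
    (P : Fin n → Step) (w : Fin n → Bool) :
    Cnd (n+1) h p u d l (Fin.cons s P : Fin (n+1) → Step) (Fin.cons b w : Fin (n+1) → Bool) ↔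
      0 ≤ h ∧ (s ≠ Step.D → b = true) ∧ ¬ (p ∧ s = Step.D ∧ b = true) ∧
      Cnd n (h + s.val) (s = Step.U) (u - if s = Step.U then 1 else 0)
        (d - if s = Step.D then 1 else 0) (l - if s = Step.L then 1 else 0) P w := by
  have e1 : (∀ i : ℕ, i ≤ n+1 → 0 ≤ h + hsum (Fin.cons s P : Fin (n+1) → Step) i) ↔
      (0 ≤ h ∧ ∀ i : ℕ, i ≤ n → 0 ≤ (h + s.val) + hsum P i) := by
    constructor
    · intro H
      refine ⟨by simpa [hsum_zero] using H 0 (by omega), fun i hi => ?_⟩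
      have := H (i+1) (by omega)
      rw [hsum_cons] at this
      linarith
    · rintro ⟨h0, H⟩ i hi
      cases i with
      | zero => simpa [hsum_zero] using h0
      | succ i =>
        rw [hsum_cons]
        have := H i (by omega)
        linarith
  have e2 : (h + hsum (Fin.cons s P : Fin (n+1) → Step) (n+1) = 0) ↔
      (h + s.val) + hsum P n = 0 := by rw [hsum_cons, add_assoc]
  unfold Cnd
  rw [e1, e2]
  simp only [Fin.sum_univ_succ, Fin.forall_fin_succ, Fin.cons_zero, Fin.cons_succ,
    Fin.val_zero, Fin.val_succ, ← eq_sub_iff_add_eq']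
  have e3 : (∀ a b : Fin n, (b:ℕ) + 1 = (a:ℕ) + 1 + 1 → ¬ (P a = Step.U ∧ P b = Step.D ∧ w b = true))
     ↔ (∀ a b : Fin n, (b:ℕ) = (a:ℕ) + 1 → ¬ (P a = Step.U ∧ P b = Step.D ∧ w b = true)) := by
    simp only [Nat.add_right_cancel_iff]
  simp only [Nat.add_eq_zero_iff, one_ne_zero, and_false, false_imp_iff, imp_true_iff, and_true,
    Nat.add_right_cancel_iff, Nat.zero_add, Nat.add_eq_right, forall_true_left, true_imp_iff]
  have e4 : ∀ x : ℕ, ¬ (0 = x + 1 + 1) := by omega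
  have e5 : ∀ x : ℕ, ¬ (0 = x + 1) := by omega
  simp only [e4, e5, false_imp_iff, imp_true_iff, true_and]
  have e6 : (∀ i : Fin n, (i:ℕ) = 0 → ¬ (s = Step.U ∧ P i = Step.D ∧ w i = true)) ↔
    (s = Step.U → ∀ b : Fin n, (b:ℕ) = 0 → ¬ (P b = Step.D ∧ w b = true)) := by
    constructor
    · intro H a b c d; exact H b c ⟨a, d⟩
    · intro H b c d; exact H d.1 b c d.2
  try rw [e6]
  tauto

open Classical in
noncomputable def S (n : ℕ) (h : ℤ) (p : Prop) (u d l : ℤ) : Polynomial ℤ :=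
  ∑ P : Fin n → Step, ∑ w : Fin n → Bool,
    if Cnd n h p u d l P w then ∏ i : Fin n, wt (h + hsum P (i : ℕ)) (P i) (w i) else 0

lemma sum_fcons {α : Type*} [Fintype α] {n : ℕ} (f : (Fin (n+1) → α) → Polynomial ℤ) :
    ∑ P, f P = ∑ s, ∑ P : Fin n → α, f (Fin.cons s P) := by
  rw [← (Fin.consEquiv (fun _ => α)).sum_comp, Fintype.sum_prod_type]
  rfl

lemma sum_step (f : Step → Polynomial ℤ) : ∑ s, f s = f .U + (f .L + f .D) := by
  have : (Finset.univ : Finset Step) = {.U, .L, .D} := rfl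
  rw [this]; simp

open Classical in
lemma S_succ_aux (n : ℕ) (h : ℤ) (p : Prop) (u d l : ℤ) : 
    S (n+1) h p u d l = ∑ s : Step, ∑ b : Bool, 
      if 0 ≤ h ∧ (s ≠ Step.D → b = true) ∧ ¬ (p ∧ s = Step.D ∧ b = true) then 
       wt h s b * S n (h + s.val) (s = Step.U) (u - if s = Step.U then 1 else 0)
        (d - if s = Step.D then 1 else 0) (l - if s = Step.L then 1 else 0) else 0 := by
  unfold S
  rw [sum_fcons]
  refine Finset.sum_congr rfl fun s _ => ?_
  simp_rw [sum_fcons (α := Bool)]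
  rw [Finset.sum_comm]
  refine Finset.sum_congr rfl fun b _ => ?_
  simp_rw [Cnd_cons, Fin.prod_univ_succ, Fin.cons_zero, Fin.cons_succ, Fin.val_zero, Fin.val_succ,
    hsum_cons, hsum_zero, add_zero, ← add_assoc]
  by_cases hc : 0 ≤ h ∧ (s ≠ Step.D → b = true) ∧ ¬ (p ∧ s = Step.D ∧ b = true)
  · rw [if_pos hc]
    obtain ⟨h1, h2, h3⟩ := hc
    simp only [h1, true_and, h3, not_false_eq_true, Finset.mul_sum, mul_ite, mul_zero]
    refine Finset.sum_congr rfl fun P _ => Finset.sum_congr rfl fun w _ => ?_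
    congr 1
    exact propext ⟨fun H => H.2, fun H => ⟨h2, H⟩⟩
  · rw [if_neg hc]
    refine Finset.sum_eq_zero fun P _ => Finset.sum_eq_zero fun w _ => ?_
    rw [if_neg]
    tauto

lemma Cnd_nonneg {n : ℕ} {h : ℤ} {p : Prop} {u d l : ℤ} {P : Fin n → Step} {w : Fin n → Bool}
    (H : Cnd n h p u d l P w) : 0 ≤ h ∧ 0 ≤ u ∧ 0 ≤ d ∧ 0 ≤ l := by
  obtain ⟨h1, h2, h3, h4, h5, -⟩ := H
  refine ⟨by simpa [hsum_zero] using h1 0 (by omega), ?_, ?_, ?_⟩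
  · rw [← h3]; exact Finset.sum_nonneg fun i _ => by split_ifs <;> simp
  · rw [← h4]; exact Finset.sum_nonneg fun i _ => by split_ifs <;> simp
  · rw [← h5]; exact Finset.sum_nonneg fun i _ => by split_ifs <;> simp

lemma S_neg (n : ℕ) (h : ℤ) (p : Prop) (u d l : ℤ) (H : h < 0 ∨ u < 0 ∨ d < 0 ∨ l < 0) :
    S n h p u d l = 0 := by
  refine Finset.sum_eq_zero fun P _ => Finset.sum_eq_zero fun w _ => ?_
  rw [if_neg]
  intro hc
  have := Cnd_nonneg hc
  omega

lemma S_zero (p : Prop) : S 0 0 p 0 0 0 = 1 := by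
  unfold S
  simp [Cnd, hsum]

open Classical in
open Polynomial in
lemma S_succ (n : ℕ) (h : ℕ) (p : Prop) (u d l : ℤ) : 
    S (n+1) h p u d l = S n (h+1) True (u-1) d l - X ^ h * S n h False u d (l-1)
      + ((if p then 0 else 1) - X ^ h) * S n (h-1) False u (d-1) l := by
  rw [S_succ_aux, sum_step]
  by_cases hp : p <;> simp [hp, wt, Step.val, ← sub_eq_add_neg] <;> ring

lemma qb_gt {R : Type*} [CommRing R] (q : R) (n k : ℕ) (h : n < k) : qbinom q n k = 0 := by
  induction n generalizing k with
  | zero => cases k with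
    | zero => omega
    | succ k => simp [qbinom]
  | succ n ih => cases k with
    | zero => omega
    | succ k => simp [qbinom, ih k (by omega), ih (k+1) (by omega)]

lemma qb_pascal {R : Type*} [CommRing R] (q : R) (u l : ℕ) :
    qbinom q (u+l+1) (u+1) = qbinom q (u+l) (u+1) + q^l * qbinom q (u+l) u := by
  suffices ∀ n u l, u + l = n → qbinom q (n+1) (u+1) = qbinom q n (u+1) + q^l * qbinom q n u from
    this _ _ _ rfl
  intro n
  induction n with
  | zero =>
    intro u l h
    obtain ⟨rfl, rfl⟩ : u = 0 ∧ l = 0 := by omega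
    simp [qbinom]
  | succ n ih =>
    intro u l h
    cases u with
    | zero =>
      obtain rfl : l = n + 1 := by omega
      have := ih 0 n (by omega)
      have e1 : qbinom q (n+1+1) (0+1) = _ := qbinom.eq_3 q (n+1) 0
      have e2 : qbinom q (n+1) (0+1) = _ := qbinom.eq_3 q n 0
      have e3 : ∀ m, qbinom q m 0 = 1 := fun m => by simp [qbinom]
      rw [e3] at *
      linear_combination e1 + q * this - e2
    | succ u =>
      cases l with
      | zero =>
        obtain rfl : u = n := by omega
        rw [qbinom, qb_gt q (u+1) (u+1+1) (by omega)]; ring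
      | succ l =>
        have h1 := ih u (l+1) (by omega)
        have h2 := ih (u+1) l (by omega)
        have e : qbinom q (n+1+1) (u+1+1) = _ := qbinom.eq_3 q (n+1) (u+1)
        have h3 : qbinom q (n+1) (u+1) = _ := qbinom.eq_3 q n u
        have h4 : qbinom q (n+1) (u+1+1) = _ := qbinom.eq_3 q n (u+1)
        linear_combination e + h1 + q^(u+2) * h2 - h4 - q^(l+1) * h3

open Polynomial in
noncomputable def A (h u l : ℕ) : Polynomial ℤ :=
  (-1)^(u+l) * X^(u*(u+1)/2) * qbinom X (u+l) u * ∏ i ∈ Finset.range h, (1 - X^(u+l+(i+1)))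

open Polynomial in
noncomputable def R (h n : ℕ) : Polynomial ℤ := ∏ i ∈ Finset.range h, (1 - X^(n+(i+1)))

lemma A_eq (h u l : ℕ) : A h u l = A 0 u l * R h (u+l) := by simp [A, R]

open Polynomial in
lemma R_succ (h n : ℕ) : R (h+1) n = R h n * (1 - X^(n+(h+1))) := by
  simp [R, Finset.prod_range_succ]

open Polynomial in
lemma R_succ' (h n : ℕ) : R (h+1) n = R h (n+1) * (1 - X^(n+1)) := by
  rw [R, Finset.prod_range_succ', R]
  congr 1
  refine Finset.prod_congr rfl fun i _ => ?_
  congr 2; ring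

open Polynomial in
/-- key: `(1 - X^n) R_{h-1}(n) = R_h(n-1)`, in the form with `n+1`. -/
lemma key1 (h n : ℕ) : (1 - X^(n+1)) * R h (n+1) = (1 - X^(n+1+h)) * R h n := by
  have h1 := R_succ h n
  have h2 := R_succ' h n
  have : n + 1 + h = n + (h+1) := by ring
  rw [this]
  linear_combination h1 - h2

lemma tri (u : ℕ) : (u+1)*(u+1+1)/2 = u*(u+1)/2 + (u+1) := by
  have : (u+1)*(u+1+1) = u*(u+1) + (u+1)*2 := by ring
  rw [this, Nat.add_mul_div_right _ _ (by norm_num)]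

open Polynomial in
lemma A0_pascal (u l : ℕ) : A 0 (u+1) (l+1) = - X^(u+l+2) * A 0 u (l+1) - A 0 (u+1) l := by
  have h := qb_pascal (X : Polynomial ℤ) u (l+1)
  have e : u+1+(l+1) = u+(l+1)+1 := by ring
  have e' : u+1+l = u+(l+1) := by ring
  simp only [A, tri, e, e', h, Finset.range_zero, Finset.prod_empty]
  ring

open Polynomial in
lemma A0_zero_right (u : ℕ) : A 0 (u+1) 0 = - X^(u+1) * A 0 u 0 := by
  have h : ∀ u, qbinom (X : Polynomial ℤ) u u = 1 := by
    intro u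
    induction u with
    | zero => simp [qbinom]
    | succ u ih => rw [qbinom, ih, qb_gt _ _ _ (by omega)]; simp
  simp only [A, tri, add_zero, h, Finset.range_zero, Finset.prod_empty]
  ring

open Polynomial in
lemma A0_zero_left (l : ℕ) : A 0 0 (l+1) = - A 0 0 l := by
  simp [A, qbinom, pow_succ]

open Polynomial in
lemma A_rec (h u l : ℕ) (H : h ≠ 0 ∨ u ≠ 0 ∨ l ≠ 0) :
    A h u l = (if u = 0 then 0 else A (h+1) (u-1) l - A h (u-1) l)
      - X^h * (if l = 0 then 0 else A h u (l-1))
      + (1 - X^h) * (if h = 0 then 0 else A (h-1) u l) := by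
  have hR : ∀ h n, R (h+1) n = R h n * (1 - X^(n+(h+1))) := R_succ
  have hR' : ∀ h n, R (h+1) n = R h (n+1) * (1 - X^(n+1)) := R_succ'
  have R0 : ∀ n, R 0 n = 1 := fun n => by simp [R]
  rcases u with _ | u <;> rcases l with _ | l
  · rcases h with _ | h
    · simp at H
    · simp only [A_eq (h+1), hR]; simp; rw [A_eq h]; simp; ring
  · rcases h with _ | h
    · simp [A0_zero_left]
    · have e : 0 + (l+1) = l+1 := by ring
      have e' : 0 + l = l := by ring
      simp only [A_eq (h+1), e]
      simp [A_eq h, A0_zero_left]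
      rw [hR' h l, hR h (l+1)]; ring
  · rcases h with _ | h
    · simp [A_eq 1, A0_zero_right, hR, R0]; ring
    · simp only [A_eq (h+1+1), A_eq (h+1)]
      simp [A_eq h, A0_zero_right]
      rw [hR (h+1) u, hR' h u, hR h (u+1)]; ring
  · rcases h with _ | h
    · simp [A_eq 1, A0_pascal, hR, R0]; ring
    · have e : u + 1 + (l+1) = u+l+1+1 := by ring
      have e1 : u + (l+1) = u+l+1 := by ring
      have e2 : u + 1 + l = u+l+1 := by ring
      simp only [A_eq (h+1+1), A_eq (h+1), A_eq h, e, e1, e2]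
      simp [A_eq (h+1+1), A_eq (h+1), A_eq h, e, e1, e2, A0_pascal]
      rw [hR (h+1) (u+l+1), hR' h (u+l+1), hR h (u+l+1+1)]; ring

lemma S_main (n : ℕ) : ∀ h u l : ℕ, n = u + (u+h) + l →
    S n h False u ((u:ℤ)+h) l = A h u l ∧
    S n h True u ((u:ℤ)+h) l = A h u l - if h = 0 then 0 else A (h-1) u l := by
  induction n with
  | zero =>
    intro h u l H
    obtain ⟨rfl, rfl, rfl⟩ : h = 0 ∧ u = 0 ∧ l = 0 := by omega
    simp [S_zero, A, qbinom]
  | succ n ih =>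
    intro h u l H
    have hU : S n ((h:ℤ)+1) True ((u:ℤ)-1) ((u:ℤ)+h) l =
        if u = 0 then 0 else A (h+1) (u-1) l - A h (u-1) l := by
      rcases u with _ | u
      · rw [S_neg _ _ _ _ _ _ (by simp)]; simp
      · have := (ih (h+1) u l (by omega)).2
        simp only [Nat.add_eq_zero_iff, one_ne_zero, and_false, if_false, Nat.add_sub_cancel] at this ⊢
        rw [← this]
        congr 1 <;> push_cast <;> ring
    have hL : S n (h:ℤ) False u ((u:ℤ)+h) ((l:ℤ)-1) =
        if l = 0 then 0 else A h u (l-1) := by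
      rcases l with _ | l
      · rw [S_neg _ _ _ _ _ _ (by simp)]; simp
      · have := (ih h u l (by omega)).1
        simp only [Nat.add_eq_zero_iff, one_ne_zero, and_false, if_false, Nat.add_sub_cancel] at this ⊢
        rw [← this]
        congr 1; push_cast; ring
    have hD : S n ((h:ℤ)-1) False u ((u:ℤ)+h-1) l =
        if h = 0 then 0 else A (h-1) u l := by
      rcases h with _ | h
      · rw [S_neg _ _ _ _ _ _ (by simp)]; simp
      · have := (ih h u l (by omega)).1
        simp only [Nat.add_eq_zero_iff, one_ne_zero, and_false, if_false, Nat.add_sub_cancel] at this ⊢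
        rw [← this]
        congr 1 <;> push_cast <;> ring
    rw [S_succ, S_succ, hU, hL, hD, A_rec h u l (by omega)]
    constructor
    · simp
    · simp only [if_true]; ring

open Polynomial in
/-- The total weight of labelled Motzkin paths of length `k+j` with `j` up
steps, `j` down steps and `k-j` level steps (up steps weighted `1`, level steps
weighted `-q^h`, down steps labelled `1` or `-q^h`, no peak both of whose steps
are labelled `1`) is `(-1)^k q^(j(j+1)/2) [k choose j]_q`.  The label `w` is
canonically `true` off down steps. -/
theorem stmt15 (j k : ℕ) (hjk : j ≤ k) :
    (∑ pw ∈ Finset.univ.filter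
        (fun pw : (Fin (k+j) → Step) × (Fin (k+j) → Bool) =>
          IsMotzkin pw.1 ∧
          (Finset.univ.filter (fun i => pw.1 i = Step.U)).card = j ∧
          (Finset.univ.filter (fun i => pw.1 i = Step.D)).card = j ∧
          (Finset.univ.filter (fun i => pw.1 i = Step.L)).card = k - j ∧
          (∀ i, pw.1 i ≠ Step.D → pw.2 i = true) ∧
          ∀ a b : Fin (k+j), (b : ℕ) = (a : ℕ) + 1 →
            ¬(pw.1 a = Step.U ∧ pw.1 b = Step.D ∧ pw.2 b = true)),
      ∏ i, (match pw.1 i with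
            | Step.U => (1 : Polynomial ℤ)
            | Step.L => -(X : Polynomial ℤ) ^ (hsum pw.1 (i : ℕ)).toNat
            | Step.D =>
                if pw.2 i then 1
                else -(X : Polynomial ℤ) ^ (hsum pw.1 (i : ℕ)).toNat))
    = (-1 : Polynomial ℤ) ^ k * X ^ (j * (j+1) / 2) *
        qbinom (X : Polynomial ℤ) k j := by
  have H := (S_main (k+j) 0 j (k-j) (by omega)).1
  have hA : A 0 j (k-j) = (-1 : Polynomial ℤ) ^ k * X ^ (j * (j+1) / 2) *
        qbinom (X : Polynomial ℤ) k j := by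
    have e : j + (k-j) = k := by omega
    simp [A, e]
  rw [← hA, ← H, S, Finset.sum_filter, Fintype.sum_prod_type]
  refine Finset.sum_congr rfl fun P _ => Finset.sum_congr rfl fun w _ => ?_
  have hc : Cnd (k+j) ((0:ℕ):ℤ) False (j:ℤ) ((j:ℤ)+((0:ℕ):ℤ)) ((k-j : ℕ):ℤ) P w ↔
      (IsMotzkin P ∧
          (Finset.univ.filter (fun i => P i = Step.U)).card = j ∧
          (Finset.univ.filter (fun i => P i = Step.D)).card = j ∧
          (Finset.univ.filter (fun i => P i = Step.L)).card = k - j ∧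
          (∀ i, P i ≠ Step.D → w i = true) ∧
          ∀ a b : Fin (k+j), (b : ℕ) = (a : ℕ) + 1 →
            ¬(P a = Step.U ∧ P b = Step.D ∧ w b = true)) := by
    have e1 : (∀ i : Fin (k+j+1), 0 ≤ hsum P (i : ℕ)) ↔ ∀ i : ℕ, i ≤ k+j → 0 ≤ hsum P i :=
      ⟨fun H i hi => H ⟨i, by omega⟩, fun H i => H i (by omega)⟩
    unfold Cnd IsMotzkin
    rw [e1]
    simp only [Finset.sum_boole, Nat.cast_zero, zero_add, add_zero, Nat.cast_inj, Nat.cast_id,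
      false_imp_iff, and_true, and_assoc]
  simp only [hc]
  split_ifs
  · refine Finset.prod_congr rfl fun i _ => ?_
    simp only [wt, Nat.cast_zero, zero_add]
  · rfl
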